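/- arXiv:2408.01535 — 2 statements merged into one kernel-verified Lean document; each statement's English description precedes it below -/
import Mathlib

section
/- For every n ≥ 5, every (5,8)-coloring of K_n uses at least (6/7)·(n−1) distinct colors; that is, f(n,5,8) ≥ (6/7)(n−1). -/
/-- The number of distinct colors appearing on the (non-loop) edges of `K_n`
inside the vertex set `S`, under the edge-coloring `c`. -/
noncomputable def numColorsOn {n : ℕ} {C : Type*} (c : Sym2 (Fin n) → C) (S : Finset (Fin n)) : ℕ :=
  (c '' {e : Sym2 (Fin n) | e ∈ S.sym2 ∧ ¬ e.IsDiag}).ncard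

/-- `c` is a `(p,q)`-coloring of `K_n`: every set of `p` vertices spans edges
bearing at least `q` distinct colors. -/
def IsPQColoring (n p q : ℕ) {C : Type*} (c : Sym2 (Fin n) → C) : Prop :=
  ∀ S : Finset (Fin n), S.card = p → q ≤ numColorsOn c S

/-- The generalized Ramsey number `f(n,p,q)`: the minimum number of colors
for which `K_n` admits a `(p,q)`-coloring. -/
noncomputable def genRamsey (n p q : ℕ) : ℕ :=
  sInf {k : ℕ | ∃ c : Sym2 (Fin n) → Fin k, IsPQColoring n p q c}

/-- Three repeated colors inside at most five vertices are impossible. -/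
lemma gr58_conf {n : ℕ} {C : Type} {c : Sym2 (Fin n) → C} (hn : 5 ≤ n)
    (h : IsPQColoring n 5 8 c) (S : Finset (Fin n)) (hS : S.card ≤ 5)
    (e1 e2 e3 f1 f2 f3 : Sym2 (Fin n))
    (m1 : e1 ∈ S.sym2 ∧ ¬ e1.IsDiag) (m2 : e2 ∈ S.sym2 ∧ ¬ e2.IsDiag)
    (m3 : e3 ∈ S.sym2 ∧ ¬ e3.IsDiag) (k1 : f1 ∈ S.sym2 ∧ ¬ f1.IsDiag)
    (k2 : f2 ∈ S.sym2 ∧ ¬ f2.IsDiag) (k3 : f3 ∈ S.sym2 ∧ ¬ f3.IsDiag)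
    (n12 : e1 ≠ e2) (n13 : e1 ≠ e3) (n23 : e2 ≠ e3)
    (g11 : f1 ≠ e1) (g12 : f1 ≠ e2) (g13 : f1 ≠ e3)
    (g22 : f2 ≠ e2) (g23 : f2 ≠ e3) (g33 : f3 ≠ e3)
    (c1 : c e1 = c f1) (c2 : c e2 = c f2) (c3 : c e3 = c f3) : False := by
  classical
  obtain ⟨T, hST, hT⟩ := Finset.exists_superset_card_eq (s := S) (n := 5) hS (by simpa using hn)
  have h8 := h T hT
  set E : Finset (Sym2 (Fin n)) := T.sym2.filter (fun e => ¬ e.IsDiag) with hE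
  have hcard : E.card = 10 := by
    have h1 := Sym2.card_image_offDiag T
    have h2 : E = T.offDiag.image (fun p => s(p.1, p.2)) := by
      ext e
      induction e with
      | _ a b =>
        simp only [hE, Finset.mem_filter, Finset.mk_mem_sym2_iff, Finset.mem_image,
          Finset.mem_offDiag, Sym2.mk_isDiag_iff]
        constructor
        · rintro ⟨⟨ha, hb⟩, hab⟩
          exact ⟨(a, b), ⟨ha, hb, hab⟩, rfl⟩
        · rintro ⟨⟨p, q⟩, ⟨hp, hq, hpq⟩, he⟩
          simp only [Sym2.eq_iff] at he
          rcases he with ⟨rfl, rfl⟩ | ⟨rfl, rfl⟩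
          · exact ⟨⟨hp, hq⟩, hpq⟩
          · exact ⟨⟨hq, hp⟩, fun hh => hpq hh.symm⟩
    rw [h2]
    rw [hT] at h1
    exact h1
  have mem : ∀ e, e ∈ S.sym2 ∧ ¬ e.IsDiag → e ∈ E := fun e he => by
    simp only [hE, Finset.mem_filter]
    exact ⟨Finset.sym2_mono hST he.1, he.2⟩
  have himg : c '' {e : Sym2 (Fin n) | e ∈ T.sym2 ∧ ¬ e.IsDiag}
      ⊆ ↑((((E.erase e1).erase e2).erase e3).image c) := by
    have b1 : ∀ e ∈ E, e ≠ e1 → e ≠ e2 → e ≠ e3 →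
        c e ∈ (((E.erase e1).erase e2).erase e3).image c := by
      intro e he x1 x2 x3
      apply Finset.mem_image_of_mem
      exact Finset.mem_erase.2 ⟨x3, Finset.mem_erase.2 ⟨x2, Finset.mem_erase.2 ⟨x1, he⟩⟩⟩
    have a1 : c e1 ∈ (((E.erase e1).erase e2).erase e3).image c := by
      rw [c1]; exact b1 _ (mem _ k1) g11 g12 g13
    have a2 : c e2 ∈ (((E.erase e1).erase e2).erase e3).image c := by
      by_cases q : f2 = e1
      · rw [c2, q]; exact a1
      · rw [c2]; exact b1 _ (mem _ k2) q g22 g23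
    have a3 : c e3 ∈ (((E.erase e1).erase e2).erase e3).image c := by
      by_cases q : f3 = e1
      · rw [c3, q]; exact a1
      by_cases q' : f3 = e2
      · rw [c3, q']; exact a2
      · rw [c3]; exact b1 _ (mem _ k3) q q' g33
    rintro _ ⟨e, he, rfl⟩
    have heE : e ∈ E := by simpa [hE] using he
    rw [Finset.mem_coe]
    by_cases q1 : e = e1
    · rw [q1]; exact a1
    by_cases q2 : e = e2
    · rw [q2]; exact a2
    by_cases q3 : e = e3
    · rw [q3]; exact a3
    exact b1 e heE q1 q2 q3
  have hle := Set.ncard_le_ncard himg (Finset.finite_toSet _)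
  rw [Set.ncard_coe_finset] at hle
  have hle2 := Finset.card_image_le (s := ((E.erase e1).erase e2).erase e3) (f := c)
  have q1 : (E.erase e1).card = 9 := by rw [Finset.card_erase_of_mem (mem _ m1), hcard]
  have q2 : ((E.erase e1).erase e2).card = 8 := by
    rw [Finset.card_erase_of_mem, q1]
    exact Finset.mem_erase.2 ⟨n12.symm, mem _ m2⟩
  have q3 : (((E.erase e1).erase e2).erase e3).card = 7 := by
    rw [Finset.card_erase_of_mem, q2]
    exact Finset.mem_erase.2 ⟨n23.symm, Finset.mem_erase.2 ⟨n13.symm, mem _ m3⟩⟩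
  unfold numColorsOn at h8
  omega

/-- Two cherries at `v` whose closing edges share a color coincide. -/
lemma gr58_cherry {n : ℕ} {C : Type} {c : Sym2 (Fin n) → C} (hn : 5 ≤ n)
    (h : IsPQColoring n 5 8 c) (v x y x' y' : Fin n)
    (hx : x ≠ v) (hy : y ≠ v) (hxy : x ≠ y) (hx' : x' ≠ v) (hy' : y' ≠ v) (hxy' : x' ≠ y')
    (e : c s(v, x) = c s(v, y)) (e' : c s(v, x') = c s(v, y'))
    (b : c s(x, y) = c s(x', y')) : (x = x' ∧ y = y') ∨ (x = y' ∧ y = x') := by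
  classical
  by_contra hne
  have key : ∀ p q r t : Fin n, p ≠ v → q ≠ v → p ≠ q → r ≠ v → t ≠ v → r ≠ t →
      c s(v, p) = c s(v, q) → c s(v, r) = c s(v, t) → c s(p, q) = c s(r, t) →
      q ≠ r → q ≠ t → p ≠ t → False := by
    intro p q r t hp hq hpq hr ht hrt e1 e2 e3 w1 w2 w3
    refine gr58_conf hn h {v, p, q, r, t} Finset.card_le_five
      s(p, q) s(v, q) s(v, t) s(r, t) s(v, p) s(v, r) ?_ ?_ ?_ ?_ ?_ ?_
      ?_ ?_ ?_ ?_ ?_ ?_ ?_ ?_ ?_ e3 e1.symm e2.symm <;>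
    simp only [Finset.mk_mem_sym2_iff, Finset.mem_insert, Finset.mem_singleton,
      Sym2.mk_isDiag_iff, ne_eq, Sym2.eq_iff] <;> grind
  have sw : ∀ a b : Fin n, s(a, b) = s(b, a) := fun a b => Sym2.eq_swap
  by_cases h1 : x = y'
  · have : y ≠ x' := by grind
    exact key x y y' x' hx hy hxy hy' hx' hxy'.symm e e'.symm (by rw [b, sw]) (by grind) this
      (by grind)
  by_cases h2 : y = y'
  · exact key y x y' x' hy hx hxy.symm hy' hx' hxy'.symm e.symm e'.symm (by rw [sw, b, sw])
      (by grind) (by grind) (by grind)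
  by_cases h3 : y = x'
  · exact key y x x' y' hy hx hxy.symm hx' hy' hxy' e.symm e' (by rw [sw, b])
      (by grind) (by grind) (by grind)
  exact key x y x' y' hx hy hxy hx' hy' hxy' e e' b (by grind) (by grind) (by grind)

/-- A cherry inside a saturated quadruple plus one vertex is the quadruple's cherry. -/
lemma gr58_sat {n : ℕ} {C : Type} {c : Sym2 (Fin n) → C} (hn : 5 ≤ n)
    (h : IsPQColoring n 5 8 c) (v x y w u v' x' y' : Fin n)
    (hx : x ≠ v) (hy : y ≠ v) (hxy : x ≠ y) (hwv : w ≠ v) (hwx : w ≠ x) (hwy : w ≠ y)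
    (hx' : x' ≠ v') (hy' : y' ≠ v') (hxy' : x' ≠ y')
    (e : c s(v, x) = c s(v, y)) (b : c s(x, y) = c s(v, w)) (nt : c s(x, y) ≠ c s(v, x))
    (e' : c s(v', x') = c s(v', y'))
    (mv : v' ∈ ({v, x, y, w, u} : Finset (Fin n)))
    (mx : x' ∈ ({v, x, y, w, u} : Finset (Fin n)))
    (my : y' ∈ ({v, x, y, w, u} : Finset (Fin n))) :
    v = v' ∧ ((x = x' ∧ y = y') ∨ (x = y' ∧ y = x')) := by
  classical
  have key : ∀ p q : Fin n, p ≠ v' → q ≠ v' → p ≠ q → c s(v', p) = c s(v', q) →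
      p ∈ ({v, x, y, w, u} : Finset (Fin n)) → q ∈ ({v, x, y, w, u} : Finset (Fin n)) →
      s(v', p) = s(x, y) ∨ s(v', p) = s(v, w) ∨ s(v', p) = s(v, x) ∨ s(v', p) = s(v, y) := by
    intro p q hp hq hpq e1 mp mq
    by_contra hcon
    push Not at hcon
    obtain ⟨t1, t2, t3, t4⟩ := hcon
    refine gr58_conf hn h {v, x, y, w, u} Finset.card_le_five
      s(x, y) s(v, x) s(v', p) s(v, w) s(v, y) s(v', q) ?_ ?_ ?_ ?_ ?_ ?_
      ?_ t1.symm t3.symm ?_ ?_ t2.symm ?_ t4.symm ?_ b e e1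
    · simp [hxy]
    · simp [hx.symm]
    · exact ⟨Finset.mk_mem_sym2_iff.2 ⟨mv, mp⟩, by simpa using hp.symm⟩
    · simp [hwv.symm]
    · simp [hy.symm]
    · exact ⟨Finset.mk_mem_sym2_iff.2 ⟨mv, mq⟩, by simpa using hq.symm⟩
    all_goals simp only [ne_eq, Sym2.eq_iff]; grind
  have k1 := key x' y' hx' hy' hxy' e' mx my
  have k2 := key y' x' hy' hx' hxy'.symm e'.symm my mx
  have d : s(v', x') ≠ s(v', y') := by simp only [ne_eq, Sym2.eq_iff]; grind
  rcases k1 with k1 | k1 | k1 | k1 <;> rcases k2 with k2 | k2 | k2 | k2 <;>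
    first
    | (exfalso; rw [k1, k2] at d; exact d rfl)
    | (exfalso; rw [k1, k2] at e'; grind)
    | (simp only [Sym2.eq_iff] at k1 k2; grind)

/-- If there is a monochromatic triangle, there are many colors. -/
lemma gr58_tri {n : ℕ} {C : Type} {c : Sym2 (Fin n) → C} (hn : 5 ≤ n)
    (h : IsPQColoring n 5 8 c) (x y z : Fin n) (hxy : x ≠ y) (hxz : x ≠ z) (hyz : y ≠ z)
    (e1 : c s(x, y) = c s(x, z)) (e2 : c s(x, y) = c s(y, z)) :
    n - 1 ≤ (c '' {e : Sym2 (Fin n) | ¬ e.IsDiag}).ncard := by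
  classical
  have key : ∀ u w p q : Fin n, u ≠ w → p ≠ q → (p = x ∨ p = y) → (u = x ∨ u = y) →
      s(u, w) ≠ s(x, z) → s(u, w) ≠ s(y, z) → s(u, w) ≠ s(x, y) →
      s(u, w) ≠ s(p, q) → c s(u, w) ≠ c s(p, q) := by
    intro u w p q huw hpq hp hu t1 t2 t3 t4 hc
    refine gr58_conf hn h {x, y, z, w, q} Finset.card_le_five
      s(x, z) s(y, z) s(u, w) s(x, y) s(x, y) s(p, q) ?_ ?_ ?_ ?_ ?_ ?_
      ?_ t1.symm t2.symm ?_ ?_ t3.symm ?_ t3.symm t4.symm e1.symm e2.symm hc <;>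
    simp only [Finset.mk_mem_sym2_iff, Finset.mem_insert, Finset.mem_singleton,
      Sym2.mk_isDiag_iff, ne_eq, Sym2.eq_iff] <;> grind
  obtain ⟨w0, hw0⟩ : ∃ w0 : Fin n, w0 ∉ ({x, y, z} : Finset (Fin n)) := by
    by_contra hcon
    push Not at hcon
    have : (Finset.univ : Finset (Fin n)).card ≤ 3 :=
      (Finset.card_le_card (fun a _ => hcon a)).trans Finset.card_le_three
    simp at this
    omega
  simp only [Finset.mem_insert, Finset.mem_singleton, not_or] at hw0
  obtain ⟨w1, w2, w3⟩ := hw0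
  have hc : (Finset.univ.erase x : Finset (Fin n)).card = n - 1 := by simp
  rw [← hc, Set.ncard_eq_toFinset_card _ (Set.toFinite _)]
  apply Finset.card_le_card_of_injOn (fun w => if w = z then c s(y, w0) else c s(x, w))
  · intro w hw
    simp only [Finset.coe_erase, Finset.coe_univ, Set.mem_sdiff, Set.mem_univ, true_and,
      Set.mem_singleton_iff] at hw
    simp only [Set.Finite.coe_toFinset]
    split_ifs
    · exact ⟨_, by simpa using fun q => w2 q.symm, rfl⟩
    · exact ⟨_, by simpa using fun q => hw q.symm, rfl⟩
  · intro a ha b hb hab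
    simp only [Finset.coe_erase, Finset.coe_univ, Set.mem_sdiff, Set.mem_univ, true_and,
      Set.mem_singleton_iff] at ha hb
    have kz : ∀ w, w ≠ x → w ≠ z → c s(y, w0) ≠ c s(x, w) := by
      intro w hw hwz
      apply key <;> simp only [ne_eq, Sym2.eq_iff] <;> grind
    by_contra hne
    simp only at hab
    split_ifs at hab with q1 q2 q2
    · grind
    · exact kz b hb q2 hab
    · exact kz a ha q1 hab.symm
    · by_cases hay : a = y
      · refine key x b x a ?_ ?_ ?_ ?_ ?_ ?_ ?_ ?_ hab.symm <;>
          simp only [ne_eq, Sym2.eq_iff] <;> grind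
      · refine key x a x b ?_ ?_ ?_ ?_ ?_ ?_ ?_ ?_ hab <;>
          simp only [ne_eq, Sym2.eq_iff] <;> grind

lemma gr58_third {n : ℕ} (a b p q r : Fin n) (hab : a ≠ b)
    (ha : a ∈ ({p, q, r} : Finset (Fin n))) (hb : b ∈ ({p, q, r} : Finset (Fin n))) :
    ∃ u, ∀ g ∈ ({p, q, r} : Finset (Fin n)), g = a ∨ g = b ∨ g = u := by
  simp only [Finset.mem_insert, Finset.mem_singleton] at ha hb ⊢
  rcases ha with rfl | rfl | rfl <;> rcases hb with rfl | rfl | rfl <;>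
    first
    | exact absurd rfl hab
    | exact ⟨p, by tauto⟩
    | exact ⟨q, by tauto⟩
    | exact ⟨r, by tauto⟩

lemma gr58_up5 {n : ℕ} (g a b p q u : Fin n) (h : g ∈ ({a, b, p, q} : Finset (Fin n))) :
    g ∈ ({a, b, p, q, u} : Finset (Fin n)) := by
  simp only [Finset.mem_insert, Finset.mem_singleton] at h ⊢
  tauto

lemma gr58_up4 {n : ℕ} (g a b p q : Fin n) (h : g ∈ ({a, b, p} : Finset (Fin n))) :
    g ∈ ({a, b, p, q} : Finset (Fin n)) := by
  simp only [Finset.mem_insert, Finset.mem_singleton] at h ⊢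
  tauto

set_option maxHeartbeats 1600000 in
lemma gr58_main {n : ℕ} {C : Type} {c : Sym2 (Fin n) → C} (hn : 5 ≤ n)
    (h : IsPQColoring n 5 8 c)
    (nt : ∀ x y z : Fin n, x ≠ y → x ≠ z → y ≠ z → c s(x, y) = c s(x, z) →
      c s(x, y) = c s(y, z) → False) :
    6 * (n - 1) ≤ 7 * (c '' {e : Sym2 (Fin n) | ¬ e.IsDiag}).ncard := by
  classical
  set K : Finset C := (Set.toFinite (c '' {e : Sym2 (Fin n) | ¬ e.IsDiag})).toFinset with hK
  rw [Set.ncard_eq_toFinset_card _ (Set.toFinite _)]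
  have memK : ∀ a b : Fin n, a ≠ b → c s(a, b) ∈ K := by
    intro a b hab
    simp only [hK, Set.Finite.mem_toFinset]
    exact ⟨_, by simpa using hab, rfl⟩
  set NF : Fin n → Fin n → Prop := fun v y => ∃ x, x < y ∧ x ≠ v ∧ c s(v, x) = c s(v, y) with hNF
  have hX0 : ∀ v y, ∃ x, NF v y → (x < y ∧ x ≠ v ∧ c s(v, x) = c s(v, y)) := by
    intro v y
    by_cases q : NF v y
    · obtain ⟨x, hx⟩ := q
      exact ⟨x, fun _ => hx⟩
    · exact ⟨y, fun q' => absurd q' q⟩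
  choose X hX using hX0
  set TB : Fin n → Fin n → Prop := fun v y => NF v y ∧ ∃ w, w ≠ v ∧ c s(X v y, y) = c s(v, w)
    with hTB
  have hW0 : ∀ v y, ∃ w, TB v y → (w ≠ v ∧ c s(X v y, y) = c s(v, w)) := by
    intro v y
    by_cases q : TB v y
    · obtain ⟨_, w, hw⟩ := q
      exact ⟨w, fun _ => hw⟩
    · exact ⟨y, fun q' => absurd q' q⟩
  choose W hW using hW0
  set D : Finset (Fin n × Fin n) := Finset.univ.offDiag with hD
  have hDc : D.card = n * (n - 1) := by
    simp [hD, Finset.offDiag_card, Nat.mul_sub]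
  set B := D.filter (fun p => TB p.1 p.2) with hB
  set A := D.filter (fun p => ¬ TB p.1 p.2) with hA
  have hAB : B.card + A.card = D.card := Finset.card_filter_add_card_filter_not _
  have hAle : A.card ≤ n * K.card := by
    have : n * K.card = ((Finset.univ : Finset (Fin n)) ×ˢ K).card := by simp
    rw [this]
    apply Finset.card_le_card_of_injOn
      (fun p => (p.1, if NF p.1 p.2 then c s(X p.1 p.2, p.2) else c s(p.1, p.2)))
    · rintro ⟨v, y⟩ hp
      simp only [hA, hD, Finset.coe_filter, Finset.mem_offDiag, Set.mem_ofPred_eq,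
        Finset.mem_univ, true_and] at hp
      simp only [Finset.coe_product, Set.mem_prod, Finset.mem_coe, Finset.mem_univ, true_and]
      split_ifs with q
      · exact memK _ _ (hX v y q).1.ne
      · exact memK _ _ hp.1
    · rintro ⟨v, y⟩ hp ⟨v', y'⟩ hp' heq
      simp only [hA, hD, Finset.coe_filter, Finset.mem_offDiag, Set.mem_ofPred_eq,
        Finset.mem_univ, true_and] at hp hp'
      simp only [Prod.mk.injEq] at heq
      obtain ⟨rfl, heq⟩ := heq
      obtain ⟨hv, hnb⟩ := hp
      obtain ⟨hv', hnb'⟩ := hp'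
      split_ifs at heq with q q' q'
      · obtain ⟨x1, x2, x3⟩ := hX v y q
        obtain ⟨z1, z2, z3⟩ := hX v y' q'
        rcases gr58_cherry hn h v _ y _ y' x2 hv.symm x1.ne z2 hv'.symm z1.ne x3 z3 heq with r | r
        · rw [r.2]
        · exfalso
          rw [r.1] at x1
          rw [← r.2] at z1
          exact lt_asymm x1 z1
      · exact absurd ⟨q, y', hv'.symm, heq⟩ hnb
      · exact absurd ⟨q', y, hv.symm, heq.symm⟩ hnb'
      · rcases lt_trichotomy y y' with r | r | r
        · exact absurd ⟨y, r, hv.symm, heq⟩ q'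
        · rw [r]
        · exact absurd ⟨y', r, hv'.symm, heq.symm⟩ q
  have hBle : 7 * B.card ≤ D.card := by
    set F : Fin n × Fin n → Finset (Fin n × Fin n) := fun p =>
      ({p.1, X p.1 p.2, p.2} : Finset (Fin n)).offDiag ∪ {(p.1, W p.1 p.2)} with hF
    -- data of a type B dart
    have data : ∀ v y, (v, y) ∈ B → X v y ≠ v ∧ y ≠ v ∧ X v y < y ∧ W v y ≠ v ∧
        W v y ≠ X v y ∧ W v y ≠ y ∧ c s(v, X v y) = c s(v, y) ∧
        c s(X v y, y) = c s(v, W v y) ∧ c s(X v y, y) ≠ c s(v, X v y) := by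
      intro v y hp
      simp only [hB, hD, Finset.mem_filter, Finset.mem_offDiag, Finset.mem_univ, true_and] at hp
      obtain ⟨hv, hb⟩ := hp
      obtain ⟨x1, x2, x3⟩ := hX v y hb.1
      obtain ⟨y1, y2⟩ := hW v y hb
      have ne : c s(X v y, y) ≠ c s(v, X v y) := fun q =>
        nt v (X v y) y x2.symm hv x1.ne x3 q.symm
      refine ⟨x2, hv.symm, x1, y1, ?_, ?_, x3, y2, ne⟩
      · intro q; rw [q] at y2; exact ne y2
      · intro q; rw [q] at y2; exact ne (y2.trans x3.symm)
    have hcardF : ∀ p ∈ B, (F p).card = 7 := by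
      rintro ⟨v, y⟩ hp
      obtain ⟨d1, d2, d3, d4, d5, d6, -⟩ := data v y hp
      have h3 : ({v, X v y, y} : Finset (Fin n)).card = 3 :=
        Finset.card_eq_three.2 ⟨_, _, _, d1.symm, d2.symm, d3.ne, rfl⟩
      simp only [hF]
      rw [Finset.card_union_of_disjoint, Finset.offDiag_card, h3]
      · simp
      · simp [Finset.mem_offDiag, d4, d5, d6]
    have hdisj : (B : Set (Fin n × Fin n)).PairwiseDisjoint F := by
      rintro ⟨v, y⟩ hp ⟨v', y'⟩ hp' hne
      rw [Function.onFun, Finset.disjoint_left]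
      rintro ⟨s, t⟩ hs hs'
      apply hne
      obtain ⟨d1, d2, d3, d4, d5, d6, d7, d8, d9⟩ := data v y hp
      obtain ⟨b1, b2, b3, b4, b5, b6, b7, b8, b9⟩ := data v' y' hp'
      simp only [hF, Finset.mem_union, Finset.mem_offDiag, Finset.mem_singleton,
        Prod.mk.injEq] at hs hs'
      have fin : v = v' ∧ ((X v y = X v' y' ∧ y = y') ∨ (X v y = y' ∧ y = X v' y')) →
          (v, y) = (v', y') := by
        rintro ⟨rfl, r | r⟩
        · rw [r.2]
        · exfalso
          have r1 := r.1
          have r2 := r.2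
          rw [r1] at d3
          rw [← r2] at b3
          exact lt_asymm d3 b3
      -- a quadruple containing two vertices of the other cherry
      have side : ∀ v y v' y' : Fin n, (v, y) ∈ B → (v', y') ∈ B → s ≠ t →
          s ∈ ({v', X v' y', y'} : Finset (Fin n)) → t ∈ ({v', X v' y', y'} : Finset (Fin n)) →
          s ∈ ({v, X v y, y, W v y} : Finset (Fin n)) →
          t ∈ ({v, X v y, y, W v y} : Finset (Fin n)) →
          v = v' ∧ ((X v y = X v' y' ∧ y = y') ∨ (X v y = y' ∧ y = X v' y')) := by
        intro v y v' y' hp hp' hst s1 t1 s2 t2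
        obtain ⟨d1, d2, d3, d4, d5, d6, d7, d8, d9⟩ := data v y hp
        obtain ⟨b1, b2, b3, b4, b5, b6, b7, b8, b9⟩ := data v' y' hp'
        obtain ⟨u, hu⟩ := gr58_third s t _ _ _ hst s1 t1
        have sub : ∀ g ∈ ({v', X v' y', y'} : Finset (Fin n)),
            g ∈ ({v, X v y, y, W v y, u} : Finset (Fin n)) := by
          intro g hg
          rcases hu g hg with r | r | r
          · rw [r]; exact gr58_up5 _ _ _ _ _ _ s2
          · rw [r]; exact gr58_up5 _ _ _ _ _ _ t2
          · rw [r]; simp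
        exact gr58_sat hn h v (X v y) y (W v y) u v' (X v' y') y' d1 d2 d3.ne d4 d5 d6 b1 b2 b3.ne
          d7 d8 d9 b7 (sub _ (by simp)) (sub _ (by simp)) (sub _ (by simp))
      have up : ∀ g v y : Fin n, g ∈ ({v, X v y, y} : Finset (Fin n)) →
          g ∈ ({v, X v y, y, W v y} : Finset (Fin n)) := by
        intro g v y hg
        exact gr58_up4 _ _ _ _ _ hg
      rcases hs with ⟨s1, s2, s3⟩ | ⟨s1, s2⟩
      · rcases hs' with ⟨t1, t2, t3⟩ | ⟨t1, t2⟩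
        · exact fin (side v y v' y' hp hp' s3 t1 t2 (up _ _ _ s1) (up _ _ _ s2))
        · have := side v' y' v y hp' hp s3 s1 s2 (by simp [t1]) (by simp [t2])
          apply fin
          obtain ⟨r1, r | r⟩ := this
          · exact ⟨r1.symm, Or.inl ⟨r.1.symm, r.2.symm⟩⟩
          · exact ⟨r1.symm, Or.inr ⟨r.2.symm, r.1.symm⟩⟩
      · rcases hs' with ⟨t1, t2, t3⟩ | ⟨t1, t2⟩
        · exact fin (side v y v' y' hp hp' t3 t1 t2 (by simp [s1]) (by simp [s2]))
        · have hvv : v = v' := s1.symm.trans t1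
          subst hvv
          have hww : W v y = W v y' := s2.symm.trans t2
          exact fin ⟨rfl, gr58_cherry hn h v _ y _ y' d1 d2 d3.ne b1 b2 b3.ne d7 b7
            (by rw [d8, b8, hww])⟩
    have hsum : (B.biUnion F).card = 7 * B.card := by
      rw [Finset.card_biUnion hdisj, Finset.sum_congr rfl hcardF]
      simp [mul_comm]
    rw [← hsum]
    apply Finset.card_le_card
    rintro ⟨s, t⟩ hst
    rw [Finset.mem_biUnion] at hst
    obtain ⟨⟨v, y⟩, hp, hst⟩ := hst
    obtain ⟨d1, d2, d3, d4, -⟩ := data v y hp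
    simp only [hF, Finset.mem_union, Finset.mem_offDiag, Finset.mem_singleton,
      Prod.mk.injEq] at hst
    simp only [hD, Finset.mem_offDiag, Finset.mem_univ, true_and]
    rcases hst with q | q
    · exact q.2.2
    · rw [q.1, q.2]; exact d4.symm
  have fin : n * (6 * (n - 1)) ≤ n * (7 * K.card) := by
    rw [hDc] at hAB hBle
    have e1 : n * (6 * (n - 1)) = 6 * (n * (n - 1)) := by ring
    have e2 : n * (7 * K.card) = 7 * (n * K.card) := by ring
    rw [e1, e2]
    omega
  exact Nat.le_of_mul_le_mul_left fin (by omega)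

lemma gr58_nat {n : ℕ} {C : Type} {c : Sym2 (Fin n) → C} (hn : 5 ≤ n)
    (h : IsPQColoring n 5 8 c) :
    6 * (n - 1) ≤ 7 * (c '' {e : Sym2 (Fin n) | ¬ e.IsDiag}).ncard := by
  by_cases q : ∃ x y z : Fin n, x ≠ y ∧ x ≠ z ∧ y ≠ z ∧ c s(x, y) = c s(x, z) ∧
      c s(x, y) = c s(y, z)
  · obtain ⟨x, y, z, h1, h2, h3, h4, h5⟩ := q
    have := gr58_tri hn h x y z h1 h2 h3 h4 h5
    omega
  · exact gr58_main hn h fun x y z h1 h2 h3 h4 h5 => q ⟨x, y, z, h1, h2, h3, h4, h5⟩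

lemma gr58_real {n : ℕ} {C : Type} {c : Sym2 (Fin n) → C} (hn : 5 ≤ n)
    (h : IsPQColoring n 5 8 c) :
    (6 / 7 : ℝ) * ((n : ℝ) - 1) ≤ ((c '' {e : Sym2 (Fin n) | ¬ e.IsDiag}).ncard : ℝ) := by
  have h1 := gr58_nat hn h
  have h2 : (6 : ℝ) * ((n - 1 : ℕ) : ℝ) ≤
      7 * ((c '' {e : Sym2 (Fin n) | ¬ e.IsDiag}).ncard : ℝ) := by exact_mod_cast h1
  rw [Nat.cast_sub (by omega)] at h2
  push_cast at h2
  linarith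

lemma gr58_exists (n : ℕ) : ∃ k : ℕ, ∃ c : Sym2 (Fin n) → Fin k, IsPQColoring n 5 8 c := by
  classical
  refine ⟨Fintype.card (Sym2 (Fin n)), Fintype.equivFin _, ?_⟩
  intro T hT
  unfold numColorsOn
  rw [Set.ncard_image_of_injective _ (Equiv.injective _)]
  have h1 := Sym2.card_image_offDiag T
  rw [hT] at h1
  have h2 : ((T.offDiag.image (fun p => s(p.1, p.2)) : Finset (Sym2 (Fin n))) : Set (Sym2 (Fin n)))
      ⊆ {e : Sym2 (Fin n) | e ∈ T.sym2 ∧ ¬ e.IsDiag} := by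
    intro e he
    rw [Finset.mem_coe, Finset.mem_image] at he
    obtain ⟨⟨p, q⟩, hpq, rfl⟩ := he
    rw [Finset.mem_offDiag] at hpq
    exact ⟨Finset.mk_mem_sym2_iff.2 ⟨hpq.1, hpq.2.1⟩, by simpa using hpq.2.2⟩
  have h3 := Set.ncard_le_ncard h2 (Set.toFinite _)
  rw [Set.ncard_coe_finset] at h3
  have h4 : (T.offDiag.image (fun p => s(p.1, p.2)) : Finset (Sym2 (Fin n))).card = 10 := by
    exact h1
  omega

/-- For `n ≥ 5`, every `(5,8)`-coloring of `K_n` uses at least `(6/7)(n−1)`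
distinct colors; that is, `f(n,5,8) ≥ (6/7)(n−1)`. -/
theorem genRamsey_five_eight_lower_bound (n : ℕ) (hn : 5 ≤ n) :
    (∀ (C : Type) (c : Sym2 (Fin n) → C), IsPQColoring n 5 8 c →
      (6 / 7 : ℝ) * ((n : ℝ) - 1) ≤ ((c '' {e : Sym2 (Fin n) | ¬ e.IsDiag}).ncard : ℝ)) ∧
    (6 / 7 : ℝ) * ((n : ℝ) - 1) ≤ (genRamsey n 5 8 : ℝ) := by
  refine ⟨fun C c h => gr58_real hn h, ?_⟩
  have hmem : genRamsey n 5 8 ∈ {k : ℕ | ∃ c : Sym2 (Fin n) → Fin k, IsPQColoring n 5 8 c} :=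
    Nat.sInf_mem (gr58_exists n)
  obtain ⟨c, hc⟩ := hmem
  refine (gr58_real hn hc).trans ?_
  have h1 := Set.ncard_le_ncard
    (Set.subset_univ (c '' {e : Sym2 (Fin n) | ¬ e.IsDiag})) (Set.toFinite _)
  rw [Set.ncard_univ, Nat.card_eq_fintype_card, Fintype.card_fin] at h1
  exact_mod_cast h1
end

section
/- Let n ≥ 6. If K_n admits a (5,8)-coloring whose colors come from a set C, then K_n admits a (5,8)-coloring with colors from C that has no monochromatic triangle; in particular the minimum number of colors of a (5,8)-coloring of K_n is attained by a coloring with no monochromatic triangle. -/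
/-- The coloring `c` has no monochromatic triangle. -/
def HasNoMonoTriangle {n : ℕ} {C : Type*} (c : Sym2 (Fin n) → C) : Prop :=
  ¬ ∃ x y z : Fin n, x ≠ y ∧ x ≠ z ∧ y ≠ z ∧
    c s(x, y) = c s(y, z) ∧ c s(x, y) = c s(x, z)

/-- The integer value of the explicit coloring: the sum of the endpoints, some of the classes being
split in two so that no five-term arithmetic progression sees three repeated colors. -/
def colVal (n a b : ℕ) : ℕ :=
  if (a + b) % 2 = 0 ∧ 8 ≤ a + b ∧ a + b + 6 ≤ 2 * n ∧
      padicValNat 2 (((a - b) + (b - a)) / 2) % 2 = 1 then 2 * n - 3 + ((a + b) / 2 - 4)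
  else if a + b = 5 ∧ (a - b) + (b - a) = 1 then 3 * n - 9
  else a + b - 1

lemma colVal_comm (n a b : ℕ) : colVal n a b = colVal n b a := by
  unfold colVal
  rw [add_comm a b, add_comm (a - b)]

lemma colVal_lt (n a b : ℕ) (hn : 6 ≤ n) (ha : a < n) (hb : b < n) : colVal n a b < 3 * n - 8 := by
  unfold colVal
  split_ifs <;> omega

lemma colVal_sum {n a b c d : ℕ} (hn : 6 ≤ n) (ha : a < n) (hb : b < n) (hc : c < n) (hd : d < n)
    (hab : a ≠ b) (hcd : c ≠ d) (h : colVal n a b = colVal n c d) : a + b = c + d := by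
  unfold colVal at h
  split_ifs at h <;> omega

lemma colVal_ap {n a g : ℕ} (hg : 0 < g) (hn : a + 4 * g < n) (hn6 : 6 ≤ n)
    (h0 : colVal n a (a + 3 * g) = colVal n (a + g) (a + 2 * g))
    (h1 : colVal n (a + g) (a + 4 * g) = colVal n (a + 2 * g) (a + 3 * g))
    (h2 : colVal n a (a + 4 * g) = colVal n (a + g) (a + 3 * g)) : False := by
  by_cases hm : 4 ≤ a + 2 * g
  · have e1 : ((a - (a + 4 * g)) + ((a + 4 * g) - a)) / 2 = 2 * g := by omega
    have e2 : (((a + g) - (a + 3 * g)) + ((a + 3 * g) - (a + g))) / 2 = g := by omega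
    have e3 : padicValNat 2 (2 * g) = 1 + padicValNat 2 g := by
      rw [padicValNat.mul (by norm_num) (by omega), padicValNat.self (by norm_num)]
    unfold colVal at h2
    rw [e1, e2, e3] at h2
    split_ifs at h2 <;> omega
  · have hg1 : g = 1 := by omega
    subst hg1
    have ha : a = 0 ∨ a = 1 := by omega
    rcases ha with rfl | rfl
    · simp [colVal] at h1
      omega
    · simp [colVal] at h0
      omega

/-- Three candidates for an eighth color. -/
lemma colVal_five {n p q r s t : ℕ} (hn : 6 ≤ n) (h1 : p < q) (h2 : q < r) (h3 : r < s) (h4 : s < t)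
    (h5 : t < n) (F : Finset ℕ)
    (hF : ∀ a ∈ [p, q, r, s, t], ∀ b ∈ [p, q, r, s, t], a < b → colVal n a b ∈ F) :
    8 ≤ F.card := by
  have H : ∀ a b c d : ℕ, a < b → b < n → c < d → d < n → a + b ≠ c + d →
      colVal n a b ≠ colVal n c d := by
    intro a b c d hab hb hcd hd hs he
    exact hs (colVal_sum hn (by omega) hb (by omega) hd (by omega) (by omega) he)
  have key : ∀ a b : ℕ, a ∈ [p, q, r, s, t] → b ∈ [p, q, r, s, t] → a < b → b < n →
      (∀ x ∈ [(p, q), (p, r), (q, r), (q, s), (r, s), (r, t), (s, t)],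
        colVal n a b ≠ colVal n x.1 x.2) → 8 ≤ F.card := by
    intro a b ha hb hab hbn hx
    have hnd : [colVal n a b, colVal n p q, colVal n p r, colVal n q r, colVal n q s,
        colVal n r s, colVal n r t, colVal n s t].Nodup := by
      simp only [List.mem_cons, List.not_mem_nil, or_false, forall_eq_or_imp, forall_eq] at hx
      simp only [List.nodup_cons, List.mem_cons, List.not_mem_nil, or_false, not_or,
        not_false_eq_true, List.nodup_nil, and_true]
      refine ⟨hx, ⟨?_, ?_, ?_, ?_, ?_, ?_⟩, ⟨?_, ?_, ?_, ?_, ?_⟩, ⟨?_, ?_, ?_, ?_⟩, ⟨?_, ?_, ?_⟩,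
        ⟨?_, ?_⟩, ?_⟩ <;> apply H <;> omega
    have hc := List.toFinset_card_of_nodup hnd
    simp only [List.length_cons, List.length_nil] at hc
    have hsub : [colVal n a b, colVal n p q, colVal n p r, colVal n q r, colVal n q s,
        colVal n r s, colVal n r t, colVal n s t].toFinset ⊆ F := by
      intro y hy
      simp only [List.mem_toFinset, List.mem_cons, List.not_mem_nil, or_false] at hy
      rcases hy with rfl | rfl | rfl | rfl | rfl | rfl | rfl | rfl
      · exact hF a ha b hb hab
      all_goals exact hF _ (by simp) _ (by simp) (by omega)
    have := Finset.card_le_card hsub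
    omega
  by_contra hcon
  have A : colVal n p s = colVal n q r := by
    by_contra hne
    refine hcon (key p s (by simp) (by simp) (by omega) (by omega) ?_)
    simp only [List.mem_cons, List.not_mem_nil, or_false, forall_eq_or_imp, forall_eq]
    refine ⟨?_, ?_, hne, ?_, ?_, ?_, ?_⟩ <;> apply H <;> omega
  have B : colVal n q t = colVal n r s := by
    by_contra hne
    refine hcon (key q t (by simp) (by simp) (by omega) (by omega) ?_)
    simp only [List.mem_cons, List.not_mem_nil, or_false, forall_eq_or_imp, forall_eq]
    refine ⟨?_, ?_, ?_, ?_, hne, ?_, ?_⟩ <;> apply H <;> omega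
  have A' : p + s = q + r :=
    colVal_sum hn (by omega) (by omega) (by omega) (by omega) (by omega) (by omega) A
  have B' : q + t = r + s :=
    colVal_sum hn (by omega) (by omega) (by omega) (by omega) (by omega) (by omega) B
  have E : colVal n p t = colVal n q s := by
    by_contra hne
    refine hcon (key p t (by simp) (by simp) (by omega) (by omega) ?_)
    simp only [List.mem_cons, List.not_mem_nil, or_false, forall_eq_or_imp, forall_eq]
    refine ⟨?_, ?_, ?_, hne, ?_, ?_, ?_⟩ <;> apply H <;> omega
  have E' : p + t = q + s :=
    colVal_sum hn (by omega) (by omega) (by omega) (by omega) (by omega) (by omega) E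
  obtain ⟨g, rfl⟩ : ∃ g, q = p + g := ⟨q - p, by omega⟩
  obtain rfl : r = p + 2 * g := by omega
  obtain rfl : s = p + 3 * g := by omega
  obtain rfl : t = p + 4 * g := by omega
  exact colVal_ap (by omega) h5 hn A B E

/-- The explicit coloring of `K_n` with `3 n - 8` colors. -/
def expCol (n : ℕ) (hn : 6 ≤ n) : Sym2 (Fin n) → Fin (3 * n - 8) :=
  Sym2.lift ⟨fun a b => ⟨colVal n a b, colVal_lt n a b hn a.2 b.2⟩, by
    intro a b
    exact Fin.ext (colVal_comm n a b)⟩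

lemma expCol_mk (n : ℕ) (hn : 6 ≤ n) (a b : Fin n) :
    (expCol n hn s(a, b) : ℕ) = colVal n a b := rfl

lemma expCol_noMono (n : ℕ) (hn : 6 ≤ n) : HasNoMonoTriangle (expCol n hn) := by
  rintro ⟨x, y, z, hxy, hxz, hyz, -, h⟩
  have h' := congrArg Fin.val h
  rw [expCol_mk, expCol_mk] at h'
  have := colVal_sum hn x.2 y.2 x.2 z.2 (fun e => hxy (Fin.ext e)) (fun e => hxz (Fin.ext e)) h'
  exact hyz (Fin.ext (by omega))

lemma expCol_pq (n : ℕ) (hn : 6 ≤ n) : IsPQColoring n 5 8 (expCol n hn) := by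
  classical
  intro S hS
  unfold numColorsOn
  set I := expCol n hn '' {e : Sym2 (Fin n) | e ∈ S.sym2 ∧ ¬ e.IsDiag} with hI
  have hfin : I.Finite := Set.toFinite _
  rw [Set.ncard_eq_toFinset_card I hfin,
    ← Finset.card_image_of_injective hfin.toFinset Fin.val_injective]
  let o := S.orderEmbOfFin hS
  have hmem : ∀ i, o i ∈ S := fun i => S.orderEmbOfFin_mem hS i
  have hlt : ∀ i j : Fin 5, i < j → (o i : ℕ) < o j := fun i j hij => by
    have := o.strictMono hij
    exact this
  refine colVal_five (p := o 0) (q := o 1) (r := o 2) (s := o 3) (t := o 4) hn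
    (hlt _ _ (by decide)) (hlt _ _ (by decide)) (hlt _ _ (by decide)) (hlt _ _ (by decide))
    (o 4).2 _ ?_
  have hL : ∀ a ∈ [(o 0 : ℕ), (o 1 : ℕ), (o 2 : ℕ), (o 3 : ℕ), (o 4 : ℕ)],
      ∃ i : Fin n, i ∈ S ∧ (i : ℕ) = a := by
    intro a ha
    simp only [List.mem_cons, List.not_mem_nil, or_false] at ha
    rcases ha with rfl | rfl | rfl | rfl | rfl <;> exact ⟨_, hmem _, rfl⟩
  intro a ha b hb hab
  obtain ⟨i, hi, rfl⟩ := hL a ha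
  obtain ⟨j, hj, rfl⟩ := hL b hb
  refine Finset.mem_image.2 ⟨expCol n hn s(i, j), ?_, expCol_mk n hn i j⟩
  rw [Set.Finite.mem_toFinset]
  refine ⟨s(i, j), ⟨Finset.mk_mem_sym2_iff.2 ⟨hi, hj⟩, ?_⟩, rfl⟩
  rw [Sym2.mk_isDiag_iff]
  rintro rfl
  omega

/-- In a five-set containing a monochromatic triangle all other edges have distinct colors. -/
lemma injOn_of_mono {n : ℕ} {C : Type} (c : Sym2 (Fin n) → C) (hc : IsPQColoring n 5 8 c)
    (x y z : Fin n) (hxy : x ≠ y) (hxz : x ≠ z) (hyz : y ≠ z)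
    (h1 : c s(x, y) = c s(y, z)) (h2 : c s(x, y) = c s(x, z))
    (S : Finset (Fin n)) (hS : S.card = 5) (hx : x ∈ S) (hy : y ∈ S) (hz : z ∈ S) :
    Set.InjOn c {e | e ∈ S.sym2 ∧ ¬ e.IsDiag ∧ e ≠ s(y, z) ∧ e ≠ s(x, z)} := by
  classical
  let F : Finset (Sym2 (Fin n)) := S.sym2.filter (fun e => ¬ e.IsDiag)
  have hFeq : F = S.offDiag.image Sym2.mk.uncurry := by
    ext e
    induction e using Sym2.ind with
    | _ a b =>
      simp only [F, Finset.mem_filter, Finset.mk_mem_sym2_iff, Sym2.mk_isDiag_iff,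
        Finset.mem_image, Finset.mem_offDiag, Prod.exists, Function.uncurry]
      constructor
      · rintro ⟨⟨ha, hb⟩, hab⟩
        exact ⟨a, b, ⟨ha, hb, hab⟩, rfl⟩
      · rintro ⟨a', b', ⟨ha, hb, hab⟩, he⟩
        rcases Sym2.eq_iff.1 he with ⟨rfl, rfl⟩ | ⟨rfl, rfl⟩
        · exact ⟨⟨ha, hb⟩, hab⟩
        · exact ⟨⟨hb, ha⟩, hab.symm⟩
  have hFc : F.card = 10 := by
    rw [hFeq]
    have := Sym2.card_image_offDiag S
    rw [hS] at this
    exact this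
  let G := (F.erase s(y, z)).erase s(x, z)
  have hne : s(x, z) ≠ s(y, z) := by
    intro he
    rcases Sym2.eq_iff.1 he with ⟨e, -⟩ | ⟨e, -⟩
    · exact hxy e
    · exact hxz e
  have hGc : G.card = 8 := by
    have a1 : s(y, z) ∈ F := by simp [F, hy, hz, hyz]
    have a2 : s(x, z) ∈ F.erase s(y, z) := by simp [F, hx, hz, hxz, hxy]
    rw [Finset.card_erase_of_mem a2, Finset.card_erase_of_mem a1, hFc]
  have hxyG : s(x, y) ∈ G := by
    simp only [G, F, Finset.mem_erase, Finset.mem_filter, Finset.mk_mem_sym2_iff,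
      Sym2.mk_isDiag_iff, ne_eq, Sym2.eq_iff]
    refine ⟨?_, ?_, ⟨hx, hy⟩, hxy⟩ <;> grind
  have himg : c '' {e : Sym2 (Fin n) | e ∈ S.sym2 ∧ ¬ e.IsDiag} ⊆ (G.image c : Finset C) := by
    rintro _ ⟨e, he, rfl⟩
    rw [Finset.mem_coe, Finset.mem_image]
    by_cases e1 : e = s(y, z)
    · exact ⟨_, hxyG, by rw [e1, h1]⟩
    by_cases e2 : e = s(x, z)
    · exact ⟨_, hxyG, by rw [e2, h2]⟩
    exact ⟨e, by simp only [G, F, Finset.mem_erase, Finset.mem_filter]; exact ⟨e2, e1, he⟩, rfl⟩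
  have h8 := hc S hS
  unfold numColorsOn at h8
  have h9 := Set.ncard_le_ncard himg (Finset.finite_toSet _)
  rw [Set.ncard_coe_finset] at h9
  have hcard : (G.image c).card = G.card :=
    le_antisymm Finset.card_image_le (by omega)
  have hinj := Finset.card_image_iff.1 hcard
  refine hinj.mono ?_
  rintro e ⟨he1, he2, he3, he4⟩
  simp only [G, F, Finset.coe_erase, Finset.coe_filter]
  exact ⟨⟨⟨he1, he2⟩, he3⟩, he4⟩

/-- A monochromatic triangle forces at least `3 n - 8` colors. -/
lemma embed_of_mono {n : ℕ} (hn : 6 ≤ n) {C : Type} (c : Sym2 (Fin n) → C)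
    (hc : IsPQColoring n 5 8 c) (h : ¬ HasNoMonoTriangle c) :
    ∃ f : Fin (3 * n - 8) → C, Function.Injective f := by
  classical
  unfold HasNoMonoTriangle at h
  obtain ⟨x, y, z, hxy, hxz, hyz, h1, h2⟩ := not_not.1 h
  let T : Finset (Fin n) := {x, y, z}
  have hT : T.card = 3 := Finset.card_eq_three.2 ⟨x, y, z, hxy, hxz, hyz, rfl⟩
  have hTc : Tᶜ.card = n - 3 := by rw [Finset.card_compl, hT, Fintype.card_fin]
  let X : Finset (Sym2 (Fin n)) := (T ×ˢ Tᶜ).image (fun p => s(p.1, p.2))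
  have hX : X.card = 3 * (n - 3) := by
    rw [Finset.card_image_of_injOn, Finset.card_product, hT, hTc]
    rintro ⟨a, u⟩ hau ⟨b, v⟩ hbv he
    simp only [Finset.coe_product, Set.mem_prod, Finset.mem_coe, Finset.mem_compl] at hau hbv
    rcases Sym2.eq_iff.1 he with ⟨e1, e2⟩ | ⟨e1, e2⟩
    · exact Prod.ext e1 e2
    · simp only at e1 e2
      exact absurd (e1 ▸ hau.1) hbv.2
  have hxT : x ∈ T := by simp [T]
  have hyT : y ∈ T := by simp [T]
  have hzT : z ∈ T := by simp [T]
  have hXs : ∀ a b : Fin n, a ∈ T → b ∈ T → s(a, b) ∉ X := by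
    intro a b ha hb hm
    obtain ⟨⟨p, q⟩, hpq, he⟩ := Finset.mem_image.1 hm
    rw [Finset.mem_product, Finset.mem_compl] at hpq
    rcases Sym2.eq_iff.1 he with ⟨e1, e2⟩ | ⟨e1, e2⟩
    · exact hpq.2 (e2 ▸ hb)
    · exact hpq.2 (e2 ▸ ha)
  let A := insert s(x, y) X
  have hA : A.card = 3 * n - 8 := by
    rw [Finset.card_insert_of_notMem (hXs x y hxT hyT), hX]
    omega
  -- every element of `A` is an edge inside `T` plus one outside vertex
  have hAe : ∀ e ∈ A, ¬ e.IsDiag ∧ e ≠ s(y, z) ∧ e ≠ s(x, z) ∧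
      ∃ u ∈ Tᶜ, e ∈ (insert u T).sym2 := by
    intro e he
    rcases Finset.mem_insert.1 he with rfl | he
    · have : Tᶜ.Nonempty := by
        rw [← Finset.card_pos]
        omega
      obtain ⟨u, hu⟩ := this
      refine ⟨by simpa using hxy, ?_, ?_, u, hu, ?_⟩
      · rw [ne_eq, Sym2.eq_iff]; grind
      · rw [ne_eq, Sym2.eq_iff]; grind
      · rw [Finset.mk_mem_sym2_iff]
        exact ⟨Finset.mem_insert_of_mem hxT, Finset.mem_insert_of_mem hyT⟩
    · have he' := he
      obtain ⟨⟨a, u⟩, hau, rfl⟩ := Finset.mem_image.1 he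
      rw [Finset.mem_product] at hau
      refine ⟨?_, ?_, ?_, u, hau.2, ?_⟩
      · rw [Sym2.mk_isDiag_iff]
        intro e1
        simp only at e1 hau
        exact Finset.mem_compl.1 hau.2 (e1 ▸ hau.1)
      · intro e1
        rw [e1] at he'
        exact hXs _ _ hyT hzT he'
      · intro e1
        rw [e1] at he'
        exact hXs _ _ hxT hzT he'
      · rw [Finset.mk_mem_sym2_iff]
        exact ⟨Finset.mem_insert_of_mem hau.1, Finset.mem_insert_self _ _⟩
  have hinj : Set.InjOn c (A : Set (Sym2 (Fin n))) := by
    intro e he f hf hef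
    obtain ⟨p1, p2, p3, u, hu, p4⟩ := hAe e he
    obtain ⟨q1, q2, q3, v, hv, q4⟩ := hAe f hf
    have hsub : ({u, v} : Finset (Fin n)) ⊆ Tᶜ := by
      intro w hw
      rcases Finset.mem_insert.1 hw with rfl | hw
      · exact hu
      · rw [Finset.mem_singleton.1 hw]; exact hv
    obtain ⟨U, hU1, hU2, hU3⟩ := Finset.exists_subsuperset_card_eq hsub
      (n := 2) Finset.card_le_two (by omega)
    have hdisj : Disjoint T U :=
      Finset.disjoint_left.2 fun w hw hwU => Finset.mem_compl.1 (hU2 hwU) hw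
    have hS : (T ∪ U).card = 5 := by rw [Finset.card_union_of_disjoint hdisj, hT, hU3]
    have hsubu : insert u T ⊆ T ∪ U := Finset.insert_subset
      (Finset.mem_union_right _ (hU1 (by simp))) Finset.subset_union_left
    have hsubv : insert v T ⊆ T ∪ U := Finset.insert_subset
      (Finset.mem_union_right _ (hU1 (by simp))) Finset.subset_union_left
    exact injOn_of_mono c hc x y z hxy hxz hyz h1 h2 (T ∪ U) hS
      (Finset.mem_union_left _ hxT) (Finset.mem_union_left _ hyT) (Finset.mem_union_left _ hzT)
      ⟨Finset.sym2_mono hsubu p4, p1, p2, p3⟩ ⟨Finset.sym2_mono hsubv q4, q1, q2, q3⟩ hef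
  let eq := A.equivFinOfCardEq hA
  refine ⟨fun i => c (eq.symm i), fun i j hij => ?_⟩
  exact eq.symm.injective (Subtype.ext (hinj (eq.symm i).2 (eq.symm j).2 hij))

lemma exists_good {n : ℕ} (hn : 6 ≤ n) {C : Type} (c : Sym2 (Fin n) → C)
    (hc : IsPQColoring n 5 8 c) :
    ∃ c' : Sym2 (Fin n) → C, IsPQColoring n 5 8 c' ∧ HasNoMonoTriangle c' := by
  by_cases h : HasNoMonoTriangle c
  · exact ⟨c, hc, h⟩
  obtain ⟨f, hf⟩ := embed_of_mono hn c hc h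
  refine ⟨f ∘ expCol n hn, ?_, ?_⟩
  · intro S hS
    have := expCol_pq n hn S hS
    unfold numColorsOn at this ⊢
    rw [Set.image_comp, Set.ncard_image_of_injective _ hf]
    exact this
  · rintro ⟨x, y, z, hxy, hxz, hyz, h1, h2⟩
    exact expCol_noMono n hn ⟨x, y, z, hxy, hxz, hyz, hf h1, hf h2⟩

/-- For `n ≥ 6`: if `K_n` has a `(5,8)`-coloring with colors from `C`, then it has
one with colors from `C` and no monochromatic triangle; in particular the minimum
number of colors of a `(5,8)`-coloring of `K_n` is attained by a coloring with no
monochromatic triangle. -/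
theorem exists_five_eight_coloring_no_mono_triangle (n : ℕ) (hn : 6 ≤ n) (C : Type)
    (h : ∃ c : Sym2 (Fin n) → C, IsPQColoring n 5 8 c) :
    (∃ c' : Sym2 (Fin n) → C, IsPQColoring n 5 8 c' ∧ HasNoMonoTriangle c') ∧
    (∃ c'' : Sym2 (Fin n) → Fin (genRamsey n 5 8),
      IsPQColoring n 5 8 c'' ∧ HasNoMonoTriangle c'') := by
  obtain ⟨c, hc⟩ := h
  refine ⟨exists_good hn c hc, ?_⟩
  have hne : {k : ℕ | ∃ c : Sym2 (Fin n) → Fin k, IsPQColoring n 5 8 c}.Nonempty :=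
    ⟨3 * n - 8, expCol n hn, expCol_pq n hn⟩
  obtain ⟨d, hd⟩ : ∃ c : Sym2 (Fin n) → Fin (genRamsey n 5 8), IsPQColoring n 5 8 c :=
    Nat.sInf_mem hne
  exact exists_good hn d hd
end
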